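/- arXiv:1709.05205 — 2 statements merged into one kernel-verified Lean document; each statement's English description precedes it below -/
import Mathlib

section
/- Let i, j < 16 with f_i (false, false) = false and f_j (false, false) = false, so that IVT_{i,j} : ℕ × ℕ → ℕ × ℕ is well defined. Then the dynamical system x_{n+1} = IVT_{i,j} (x_n) is Collatz-like (i.e. for every (m, n) ∈ ℕ × ℕ there exists N with IVT_{i,j}^[N] (m, n) = (0, 0)) if and only if there exists k ∈ ℕ such that f_{i,j}^[k] (x) = (false, false) for every x ∈ Bool × Bool, where f_{i,j}^[k] denotes the k-fold iterate. -/
/-- The 2-variable Boolean function with truth table given by the binary expansion of `i`. -/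
def f (i : ℕ) (p : Bool × Bool) : Bool :=
  Nat.testBit i (2 * (cond p.1 1 0) + (cond p.2 1 0))

/-- The pair map `f_{i,j} (x, y) = (f_i (x, y), f_j (x, y))`. -/
def fPair (i j : ℕ) (p : Bool × Bool) : Bool × Bool := (f i p, f j p)

/-- Iterates of a digitwise map act on every pair of binary digits by iterates of `fPair`. -/
theorem testBit_iterate (i j : ℕ) (IVT : ℕ × ℕ → ℕ × ℕ)
    (hIVT : ∀ m n k : ℕ,
      (IVT (m, n)).1.testBit k = f i (m.testBit k, n.testBit k) ∧
      (IVT (m, n)).2.testBit k = f j (m.testBit k, n.testBit k))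
    (N : ℕ) (p : ℕ × ℕ) (k : ℕ) :
    ((IVT^[N] p).1.testBit k, (IVT^[N] p).2.testBit k) =
      (fPair i j)^[N] (p.1.testBit k, p.2.testBit k) := by
  induction N generalizing p with
  | zero => rfl
  | succ N ih =>
    obtain ⟨m, n⟩ := p
    rw [Function.iterate_succ_apply, Function.iterate_succ_apply, ih, (hIVT m n k).1,
      (hIVT m n k).2]
    rfl

theorem stmt8 (i j : ℕ) (hi : i < 16) (hj : j < 16)
    (hfi : f i (false, false) = false) (hfj : f j (false, false) = false)
    (IVT : ℕ × ℕ → ℕ × ℕ)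
    -- `IVT` is the Integral Value Transformation `IVT_{i,j}`: the k-th binary digit of each
    -- component of `IVT (m, n)` is `f i` (resp. `f j`) of the k-th binary digits of `m` and `n`
    (hIVT : ∀ m n k : ℕ,
      (IVT (m, n)).1.testBit k = f i (m.testBit k, n.testBit k) ∧
      (IVT (m, n)).2.testBit k = f j (m.testBit k, n.testBit k)) :
    -- the system is Collatz-like iff some iterate of `f_{i,j}` is constantly `(false, false)`
    (∀ m n : ℕ, ∃ N : ℕ, IVT^[N] (m, n) = (0, 0)) ↔
      ∃ k : ℕ, ∀ x : Bool × Bool, (fPair i j)^[k] x = (false, false) := by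
  constructor
  · intro h
    -- the binary digits of 12 and 10 run through all four pairs
    obtain ⟨N, hN⟩ := h 12 10
    refine ⟨N, fun x => ?_⟩
    obtain ⟨k, hk⟩ : ∃ k : ℕ, (Nat.testBit 12 k, Nat.testBit 10 k) = x := by
      rcases x with ⟨_ | _, _ | _⟩
      exacts [⟨0, by decide⟩, ⟨1, by decide⟩, ⟨2, by decide⟩, ⟨3, by decide⟩]
    have := testBit_iterate i j IVT hIVT N (12, 10) k
    rw [hN] at this
    simpa [hk] using this.symm
  · rintro ⟨N, hN⟩ m n
    refine ⟨N, Prod.ext (Nat.eq_of_testBit_eq fun k => ?_) (Nat.eq_of_testBit_eq fun k => ?_)⟩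
    all_goals
      have := testBit_iterate i j IVT hIVT N (m, n) k
      rw [hN, Prod.mk.injEq] at this
      simp [this]
end

section
/- The set of pairs (i, j) ∈ Finset.range 16 ×ˢ Finset.range 16 such that there exists k ∈ ℕ with f_{i,j}^[k] (x) = (false, false) for every x ∈ Bool × Bool equals exactly the 16-element set {(0,0), (0,4), (0,8), (0,12), (2,0), (2,2), (2,6), (2,8), (4,4), (4,12), (6,4), (6,6), (8,0), (8,4), (10,0), (10,2)}. -/
/-- A self-map of a finite type some iterate of which is constantly `a` reaches `a` everywhere
after `Fintype.card α` steps. -/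
theorem exists_iterate_eq_const_iff {α : Type*} [Fintype α] (g : α → α) (a : α) :
    (∃ k : ℕ, ∀ x, g^[k] x = a) ↔ ∀ x, g^[Fintype.card α] x = a := by
  refine ⟨fun ⟨k, hk⟩ x => ?_, fun h => ⟨_, h⟩⟩
  have ha : Function.IsFixedPt g a := by
    have h := hk (g a)
    rwa [← Function.iterate_succ_apply, Function.iterate_succ_apply', hk] at h
  obtain ⟨i, j, hij, hx⟩ : ∃ i j : Fin (Fintype.card α + 1), i < j ∧ g^[i] x = g^[j] x := by
    obtain ⟨i, j, hne, h⟩ := Fintype.exists_ne_map_eq_of_card_lt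
      (fun i : Fin (Fintype.card α + 1) => g^[i] x) (by simp)
    rcases lt_or_gt_of_ne hne with hlt | hlt
    · exact ⟨i, j, hlt, h⟩
    · exact ⟨j, i, hlt, h.symm⟩
  have hlt : (i : ℕ) < j := hij
  have hper : Function.IsPeriodicPt g (j - i) (g^[i] x) := by
    rw [Function.IsPeriodicPt, Function.IsFixedPt, ← Function.iterate_add_apply,
      Nat.sub_add_cancel hlt.le, hx]
  have hle : k ≤ (j - i) * k := Nat.le_mul_of_pos_left k (Nat.sub_pos_of_lt hlt)
  have hy : g^[i] x = a := by
    rw [← (hper.mul_const k).eq, ← Nat.add_sub_cancel' hle, Function.iterate_add_apply, hk]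
  rw [← Nat.sub_add_cancel (Nat.le_of_lt_succ i.isLt), Function.iterate_add_apply, hy]
  exact ha.iterate _

open scoped Classical in
theorem stmt10 :
    (Finset.range 16 ×ˢ Finset.range 16).filter
        (fun p => ∃ k : ℕ, ∀ x : Bool × Bool, (fPair p.1 p.2)^[k] x = (false, false)) =
      ({(0, 0), (0, 4), (0, 8), (0, 12), (2, 0), (2, 2), (2, 6), (2, 8),
        (4, 4), (4, 12), (6, 4), (6, 6), (8, 0), (8, 4), (10, 0), (10, 2)} :
        Finset (ℕ × ℕ)) := by
  have key : (Finset.range 16 ×ˢ Finset.range 16).filter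
        (fun p => ∀ x : Bool × Bool, (fPair p.1 p.2)^[4] x = (false, false)) =
      ({(0, 0), (0, 4), (0, 8), (0, 12), (2, 0), (2, 2), (2, 6), (2, 8),
        (4, 4), (4, 12), (6, 4), (6, 6), (8, 0), (8, 4), (10, 0), (10, 2)} :
        Finset (ℕ × ℕ)) := by
    decide +kernel
  rw [← key]
  exact Finset.filter_congr fun p _ => exists_iterate_eq_const_iff (fPair p.1 p.2) (false, false)
end
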